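/- (Analyticity of the surface impedance tensor.) Let C be an elastic tensor. For (l₁,l₂) in the open unit disk D = {(l₁,l₂) ∈ ℝ² : l₁² + l₂² < 1}, let l = (l₁, l₂, √(1 - l₁² - l₂²)), define S₁(l), S₂(l) as above, and set Z(l) = S₂(l)⁻¹ + i·S₂(l)⁻¹·S₁(l), a 3×3 complex matrix. Then the map (l₁,l₂) ↦ Z(l) is real-analytic on D (each complex entry is a real-analytic function of (l₁,l₂)). -/

import Mathlib

/-- The matrix `T(n)_{ik} = ∑_{j,l} C i j k l * n j * n l`. -/
noncomputable def acousticT (C : Fin 3 → Fin 3 → Fin 3 → Fin 3 → ℝ)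
    (n : EuclideanSpace ℝ (Fin 3)) : Matrix (Fin 3) (Fin 3) ℝ :=
  Matrix.of fun i k => ∑ j, ∑ l, C i j k l * n j * n l

/-- The matrix `R(m,n)_{ik} = ∑_{j,l} C i j k l * m j * n l`. -/
noncomputable def matR (C : Fin 3 → Fin 3 → Fin 3 → Fin 3 → ℝ)
    (m n : EuclideanSpace ℝ (Fin 3)) : Matrix (Fin 3) (Fin 3) ℝ :=
  Matrix.of fun i k => ∑ j, ∑ l, C i j k l * m j * n l

/-- `m₀ = (1-l₁²)^{-1/2} (1-l₁², -l₁l₂, -l₁l₃)`. -/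
noncomputable def mZero (l : EuclideanSpace ℝ (Fin 3)) : EuclideanSpace ℝ (Fin 3) :=
  (Real.sqrt (1 - (l 0) ^ 2))⁻¹ •
    (WithLp.equiv 2 (Fin 3 → ℝ)).symm ![1 - (l 0) ^ 2, -(l 0) * (l 1), -(l 0) * (l 2)]

/-- `n₀ = (1-l₁²)^{-1/2} (0, l₃, -l₂)`. -/
noncomputable def nZero (l : EuclideanSpace ℝ (Fin 3)) : EuclideanSpace ℝ (Fin 3) :=
  (Real.sqrt (1 - (l 0) ^ 2))⁻¹ • (WithLp.equiv 2 (Fin 3 → ℝ)).symm ![0, l 2, -(l 1)]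

/-- `m_φ = m₀ cos φ + n₀ sin φ`. -/
noncomputable def mPhi (l : EuclideanSpace ℝ (Fin 3)) (φ : ℝ) : EuclideanSpace ℝ (Fin 3) :=
  Real.cos φ • mZero l + Real.sin φ • nZero l

/-- `n_φ = -m₀ sin φ + n₀ cos φ`. -/
noncomputable def nPhi (l : EuclideanSpace ℝ (Fin 3)) (φ : ℝ) : EuclideanSpace ℝ (Fin 3) :=
  (-Real.sin φ) • mZero l + Real.cos φ • nZero l

/-- `S₁(l) = -(1/(2π)) ∫₀^{2π} T(n_φ)⁻¹ R(m_φ,n_φ)ᵀ dφ` (entrywise integral). -/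
noncomputable def SOne (C : Fin 3 → Fin 3 → Fin 3 → Fin 3 → ℝ)
    (l : EuclideanSpace ℝ (Fin 3)) : Matrix (Fin 3) (Fin 3) ℝ :=
  Matrix.of fun i k =>
    -(2 * Real.pi)⁻¹ * ∫ φ in (0:ℝ)..(2 * Real.pi),
      ((acousticT C (nPhi l φ))⁻¹ * (matR C (mPhi l φ) (nPhi l φ)).transpose) i k

/-- `S₂(l) = (1/(2π)) ∫₀^{2π} T(n_φ)⁻¹ dφ` (entrywise integral). -/
noncomputable def STwo (C : Fin 3 → Fin 3 → Fin 3 → Fin 3 → ℝ)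
    (l : EuclideanSpace ℝ (Fin 3)) : Matrix (Fin 3) (Fin 3) ℝ :=
  Matrix.of fun i k =>
    (2 * Real.pi)⁻¹ * ∫ φ in (0:ℝ)..(2 * Real.pi), (acousticT C (nPhi l φ))⁻¹ i k

/-- The unit vector `l = (l₁, l₂, √(1-l₁²-l₂²))` parametrized by the unit disk. -/
noncomputable def lVec (p : ℝ × ℝ) : EuclideanSpace ℝ (Fin 3) :=
  (WithLp.equiv 2 (Fin 3 → ℝ)).symm ![p.1, p.2, Real.sqrt (1 - p.1 ^ 2 - p.2 ^ 2)]

/-- The surface impedance tensor `Z(l) = S₂(l)⁻¹ + i S₂(l)⁻¹ S₁(l)`. -/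
noncomputable def surfaceImpedance (C : Fin 3 → Fin 3 → Fin 3 → Fin 3 → ℝ)
    (l : EuclideanSpace ℝ (Fin 3)) : Matrix (Fin 3) (Fin 3) ℂ :=
  Matrix.of fun i k =>
    (((STwo C l)⁻¹ i k : ℝ) : ℂ) + Complex.I * ((((STwo C l)⁻¹ * SOne C l) i k : ℝ) : ℂ)

open intervalIntegral

section MatrixAnalytic

variable {n A E : Type*} [Fintype n] [DecidableEq n] [NormedCommRing A] [NormedAlgebra ℝ A]
  [NormedAddCommGroup E] [NormedSpace ℝ E]

theorem analyticAt_matrix_det {M : E → Matrix n n A} {p : E}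
    (hM : ∀ i j, AnalyticAt ℝ (fun q => M q i j) p) : AnalyticAt ℝ (fun q => (M q).det) p := by
  simp only [Matrix.det_apply']
  exact Finset.analyticAt_fun_sum _ fun σ _ =>
    analyticAt_const.mul (Finset.analyticAt_fun_prod _ fun i _ => hM _ _)

theorem analyticAt_matrix_adjugate {M : E → Matrix n n A} {p : E}
    (hM : ∀ i j, AnalyticAt ℝ (fun q => M q i j) p) (i j : n) :
    AnalyticAt ℝ (fun q => (M q).adjugate i j) p := by
  simp only [Matrix.adjugate_apply]
  refine analyticAt_matrix_det fun a b => ?_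
  by_cases h : a = j
  · subst h
    simpa only [Matrix.updateRow_self] using analyticAt_const
  · simpa only [Matrix.updateRow_ne h] using hM a b

theorem analyticAt_matrix_inv [HasSummableGeomSeries A] {M : E → Matrix n n A} {p : E}
    (hM : ∀ i j, AnalyticAt ℝ (fun q => M q i j) p) (hp : IsUnit (M p).det) (i j : n) :
    AnalyticAt ℝ (fun q => (M q)⁻¹ i j) p := by
  simp only [Matrix.inv_def, Matrix.smul_apply, smul_eq_mul]
  obtain ⟨u, hu⟩ := hp
  have hinv : AnalyticAt ℝ (Ring.inverse : A → A) (M p).det := hu ▸ analyticAt_inverse u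
  exact (AnalyticAt.fun_comp (f := fun q => (M q).det) hinv
    (analyticAt_matrix_det hM)).fun_mul (analyticAt_matrix_adjugate hM i j)

omit [DecidableEq n] in
theorem analyticAt_matrix_mul {M N : E → Matrix n n A} {p : E}
    (hM : ∀ i j, AnalyticAt ℝ (fun q => M q i j) p)
    (hN : ∀ i j, AnalyticAt ℝ (fun q => N q i j) p) (i j : n) :
    AnalyticAt ℝ (fun q => (M q * N q) i j) p := by
  simp only [Matrix.mul_apply]
  exact Finset.analyticAt_fun_sum _ fun k _ => (hM i k).mul (hN k j)

end MatrixAnalytic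

theorem Matrix.map_inv_of_isUnit_det {n R S : Type*} [Fintype n] [DecidableEq n] [CommRing R]
    [CommRing S] (f : R →+* S) {M : Matrix n n R} (hM : IsUnit M.det) :
    M⁻¹.map f = (M.map f)⁻¹ := by
  refine (Matrix.inv_eq_left_inv ?_).symm
  rw [← Matrix.map_mul, Matrix.nonsing_inv_mul _ hM, Matrix.map_one f f.map_zero f.map_one]

section IntegralCLM

variable {a b : ℝ}

/-- Integration over `[a, b]` as a continuous linear functional on `C([a, b], ℝ)`. -/
noncomputable def integralIccCLM (h : a ≤ b) : C(Set.Icc a b, ℝ) →L[ℝ] ℝ :=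
  LinearMap.mkContinuous
    { toFun := fun f => ∫ x in a..b, f (Set.projIcc a b h x)
      map_add' := fun f g => by
        have hf : Continuous fun x => f (Set.projIcc a b h x) :=
          f.continuous.comp continuous_projIcc
        have hg : Continuous fun x => g (Set.projIcc a b h x) :=
          g.continuous.comp continuous_projIcc
        exact integral_add (hf.intervalIntegrable _ _) (hg.intervalIntegrable _ _)
      map_smul' := fun c f => integral_smul c _ }
    |b - a| fun f => by
      rw [mul_comm]
      exact norm_integral_le_of_norm_le_const fun x _ => f.norm_coe_le_norm _

theorem integralIccCLM_eq (h : a ≤ b) (f : C(Set.Icc a b, ℝ)) {g : ℝ → ℝ}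
    (hfg : ∀ x : Set.Icc a b, f x = g x) : integralIccCLM h f = ∫ x in a..b, g x := by
  refine integral_congr fun x hx => ?_
  rw [Set.uIcc_of_le h] at hx
  simp only [Set.projIcc_of_mem h hx, hfg]

theorem integralIccCLM_pos (h : a < b) {f : C(Set.Icc a b, ℝ)} (hf : ∀ x, 0 < f x) :
    0 < integralIccCLM h.le f :=
  intervalIntegral_pos_of_pos
    ((f.continuous.comp continuous_projIcc).intervalIntegrable _ _) (fun _ => hf _) h

end IntegralCLM

section Elastic

variable {C : Fin 3 → Fin 3 → Fin 3 → Fin 3 → ℝ}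

theorem dotProduct_acousticT_mulVec (hsym1 : ∀ i j k l, C i j k l = C i j l k)
    (hsym2 : ∀ i j k l, C i j k l = C k l i j) (n : EuclideanSpace ℝ (Fin 3)) (v : Fin 3 → ℝ) :
    v ⬝ᵥ (acousticT C n).mulVec v = ∑ i, ∑ j, ∑ k, ∑ l, C i j k l *
      ((v i * n j + v j * n i) / 2) * ((v k * n l + v l * n k) / 2) := by
  have hsym3 : ∀ i j k l, C i j k l = C j i k l := fun i j k l => by
    rw [hsym2, hsym1, hsym2]
  have hleft : ∀ g : Fin 3 → Fin 3 → ℝ,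
      ∑ i, ∑ j, ∑ k, ∑ l, C i j k l * ((v i * n j + v j * n i) / 2) * g k l =
        ∑ i, ∑ j, ∑ k, ∑ l, C i j k l * (v i * n j) * g k l := fun g => by
    have hswap : ∑ i, ∑ j, ∑ k, ∑ l, C i j k l * (v j * n i) * g k l =
        ∑ i, ∑ j, ∑ k, ∑ l, C i j k l * (v i * n j) * g k l := by
      rw [Finset.sum_comm]
      simp only [fun i j k l => hsym3 j i k l]
    calc _ = 1 / 2 * (∑ i, ∑ j, ∑ k, ∑ l, C i j k l * (v i * n j) * g k l +
          ∑ i, ∑ j, ∑ k, ∑ l, C i j k l * (v j * n i) * g k l) := by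
          simp only [Finset.mul_sum, ← Finset.sum_add_distrib]
          exact Finset.sum_congr rfl fun i _ => Finset.sum_congr rfl fun j _ =>
            Finset.sum_congr rfl fun k _ => Finset.sum_congr rfl fun l _ => by ring
      _ = _ := by rw [hswap]; ring
  have hright : ∀ i j, ∑ k, ∑ l, C i j k l * (v i * n j) * ((v k * n l + v l * n k) / 2) =
      ∑ k, ∑ l, C i j k l * (v i * n j) * (v k * n l) := fun i j => by
    have hswap : ∑ k, ∑ l, C i j k l * (v i * n j) * (v l * n k) =
        ∑ k, ∑ l, C i j k l * (v i * n j) * (v k * n l) := by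
      rw [Finset.sum_comm]
      exact Finset.sum_congr rfl fun k _ => Finset.sum_congr rfl fun l _ => by rw [hsym1]
    calc _ = 1 / 2 * (∑ k, ∑ l, C i j k l * (v i * n j) * (v k * n l) +
          ∑ k, ∑ l, C i j k l * (v i * n j) * (v l * n k)) := by
          simp only [Finset.mul_sum, ← Finset.sum_add_distrib]
          exact Finset.sum_congr rfl fun k _ => Finset.sum_congr rfl fun l _ => by ring
      _ = _ := by rw [hswap]; ring
  rw [hleft fun k l => (v k * n l + v l * n k) / 2]
  simp only [hright, acousticT, dotProduct, Matrix.mulVec, Matrix.of_apply, Finset.mul_sum,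
    Finset.sum_mul]
  refine Finset.sum_congr rfl fun i _ => ?_
  rw [Finset.sum_comm]
  exact Finset.sum_congr rfl fun j _ => Finset.sum_congr rfl fun k _ =>
    Finset.sum_congr rfl fun l _ => by ring

theorem acousticT_posDef (hsym1 : ∀ i j k l, C i j k l = C i j l k)
    (hsym2 : ∀ i j k l, C i j k l = C k l i j)
    (hconv : ∃ lam : ℝ, 0 < lam ∧ ∀ ε : Matrix (Fin 3) (Fin 3) ℝ, ε.IsSymm →
      lam * ∑ i, ∑ j, (ε i j) ^ 2 ≤ ∑ i, ∑ j, ∑ k, ∑ l, C i j k l * ε i j * ε k l)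
    {n : EuclideanSpace ℝ (Fin 3)} (hn : n ≠ 0) : (acousticT C n).PosDef := by
  obtain ⟨lam, hlam, hC⟩ := hconv
  refine Matrix.PosDef.of_dotProduct_mulVec_pos ?_ fun v hv => ?_
  · ext i k
    simp only [acousticT, Matrix.conjTranspose_apply, Matrix.of_apply, star_trivial]
    rw [Finset.sum_comm]
    refine Finset.sum_congr rfl fun j _ => Finset.sum_congr rfl fun l _ => ?_
    rw [hsym2 k l i j]
    ring
  · rw [star_trivial, dotProduct_acousticT_mulVec hsym1 hsym2]
    refine lt_of_lt_of_le (mul_pos hlam ?_)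
      (hC (Matrix.of fun i j => (v i * n j + v j * n i) / 2) ?_)
    · by_contra hle
      have hzero : ∀ i j, v i * n j + v j * n i = 0 := fun i j => by
        have hsum := le_antisymm (not_lt.mp hle) (by positivity)
        rw [Finset.sum_eq_zero_iff_of_nonneg (fun _ _ => by positivity)] at hsum
        have hrow := hsum i (Finset.mem_univ _)
        rw [Finset.sum_eq_zero_iff_of_nonneg (fun _ _ => by positivity)] at hrow
        have hentry := pow_eq_zero_iff two_ne_zero |>.mp (hrow j (Finset.mem_univ _))
        simp only [Matrix.of_apply] at hentry
        linarith
      obtain ⟨a, ha⟩ := Function.ne_iff.mp hv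
      have hna : n a = 0 := by
        have h := hzero a a
        have h' : v a * n a = 0 := by linarith
        exact (mul_eq_zero.mp h').resolve_left ha
      refine hn (PiLp.ext fun j => ?_)
      have h := hzero a j
      rw [hna, mul_zero, add_zero] at h
      exact (mul_eq_zero.mp h).resolve_left ha
    · ext i j
      simp only [Matrix.transpose_apply, Matrix.of_apply]
      ring

end Elastic

theorem nPhi_ne_zero {p : ℝ × ℝ} (hp : p.1 ^ 2 + p.2 ^ 2 < 1) (φ : ℝ) :
    nPhi (lVec p) φ ≠ 0 := by
  intro h
  have h1 : 0 < 1 - p.1 ^ 2 := by nlinarith [sq_nonneg p.2]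
  have h3 : 0 < 1 - p.1 ^ 2 - p.2 ^ 2 := by linarith
  have hs1 := (Real.sqrt_pos.mpr h1).ne'
  have hs3 := (Real.sqrt_pos.mpr h3).ne'
  have hsin : Real.sin φ = 0 := by
    have := congrArg (fun x : EuclideanSpace ℝ (Fin 3) => x 0) h
    simpa [nPhi, mZero, nZero, lVec, hs1, h1.ne'] using this
  have hcos : Real.cos φ = 0 := by
    have := congrArg (fun x : EuclideanSpace ℝ (Fin 3) => x 1) h
    simpa [nPhi, mZero, nZero, lVec, hs1, hs3, hsin] using this
  simpa [hsin, hcos] using Real.sin_sq_add_cos_sq φ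

theorem analyticAt_lVec {p : ℝ × ℝ} (hp : p.1 ^ 2 + p.2 ^ 2 < 1) (j : Fin 3) :
    AnalyticAt ℝ (fun q => lVec q j) p := by
  have hfst : AnalyticAt ℝ (fun q : ℝ × ℝ => q.1) p := analyticAt_fst
  have hsnd : AnalyticAt ℝ (fun q : ℝ × ℝ => q.2) p := analyticAt_snd
  have h3 : 1 - p.1 ^ 2 - p.2 ^ 2 ≠ 0 := by linarith
  fin_cases j
  · exact hfst
  · exact hsnd
  · exact (Real.contDiffAt_sqrt h3).analyticAt.fun_comp (f := fun q : ℝ × ℝ => 1 - q.1 ^ 2 - q.2 ^ 2)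
      ((analyticAt_const.fun_sub (hfst.fun_pow 2)).fun_sub (hsnd.fun_pow 2))

theorem analyticAt_inv_sqrt_one_sub_sq {p : ℝ × ℝ} (hp : p.1 ^ 2 + p.2 ^ 2 < 1) :
    AnalyticAt ℝ (fun q => (Real.sqrt (1 - (lVec q 0) ^ 2))⁻¹) p := by
  have h1 : 0 < 1 - p.1 ^ 2 := by nlinarith [sq_nonneg p.2]
  exact ((Real.contDiffAt_sqrt h1.ne').analyticAt.fun_comp (f := fun q : ℝ × ℝ => 1 - q.1 ^ 2)
    (analyticAt_const.fun_sub (analyticAt_fst.fun_pow 2))).inv (Real.sqrt_pos.mpr h1).ne'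

theorem analyticAt_mZero {p : ℝ × ℝ} (hp : p.1 ^ 2 + p.2 ^ 2 < 1) (j : Fin 3) :
    AnalyticAt ℝ (fun q => mZero (lVec q) j) p := by
  have h0 := analyticAt_lVec hp 0
  have h1 := analyticAt_lVec hp 1
  have h2 := analyticAt_lVec hp 2
  refine (analyticAt_inv_sqrt_one_sub_sq hp).mul ?_
  fin_cases j
  · exact analyticAt_const.sub (h0.pow 2)
  · exact h0.neg.mul h1
  · exact h0.neg.mul h2

theorem analyticAt_nZero {p : ℝ × ℝ} (hp : p.1 ^ 2 + p.2 ^ 2 < 1) (j : Fin 3) :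
    AnalyticAt ℝ (fun q => nZero (lVec q) j) p := by
  refine (analyticAt_inv_sqrt_one_sub_sq hp).mul ?_
  fin_cases j
  · exact analyticAt_const
  · exact analyticAt_lVec hp 2
  · exact (analyticAt_lVec hp 1).neg

section Lift

/-- The cosine as an element of `C([0, 2π], ℝ)`. -/
noncomputable def cosIcc : C(Set.Icc 0 (2 * Real.pi), ℝ) :=
  ⟨fun φ => Real.cos φ, by fun_prop⟩

/-- The sine as an element of `C([0, 2π], ℝ)`. -/
noncomputable def sinIcc : C(Set.Icc 0 (2 * Real.pi), ℝ) :=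
  ⟨fun φ => Real.sin φ, by fun_prop⟩

/-- The components of `φ ↦ m_φ` as continuous functions on `[0, 2π]`. -/
noncomputable def mPhiIcc (p : ℝ × ℝ) (j : Fin 3) : C(Set.Icc 0 (2 * Real.pi), ℝ) :=
  mZero (lVec p) j • cosIcc + nZero (lVec p) j • sinIcc

/-- The components of `φ ↦ n_φ` as continuous functions on `[0, 2π]`. -/
noncomputable def nPhiIcc (p : ℝ × ℝ) (j : Fin 3) : C(Set.Icc 0 (2 * Real.pi), ℝ) :=
  nZero (lVec p) j • cosIcc - mZero (lVec p) j • sinIcc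

/-- The matrix `(∑_{j,l} C i j k l u_j v_l)_{ik}` over `C([0, 2π], ℝ)`. -/
noncomputable def contractIcc (C : Fin 3 → Fin 3 → Fin 3 → Fin 3 → ℝ)
    (u v : Fin 3 → C(Set.Icc 0 (2 * Real.pi), ℝ)) :
    Matrix (Fin 3) (Fin 3) C(Set.Icc 0 (2 * Real.pi), ℝ) :=
  Matrix.of fun i k => ∑ j, ∑ l, C i j k l • (u j * v l)

theorem mPhiIcc_apply (p : ℝ × ℝ) (j : Fin 3) (φ : Set.Icc 0 (2 * Real.pi)) :
    mPhiIcc p j φ = mPhi (lVec p) φ j := by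
  simp [mPhiIcc, mPhi, cosIcc, sinIcc, mul_comm]

theorem nPhiIcc_apply (p : ℝ × ℝ) (j : Fin 3) (φ : Set.Icc 0 (2 * Real.pi)) :
    nPhiIcc p j φ = nPhi (lVec p) φ j := by
  simp [nPhiIcc, nPhi, cosIcc, sinIcc]
  ring

theorem analyticAt_mPhiIcc {p : ℝ × ℝ} (hp : p.1 ^ 2 + p.2 ^ 2 < 1) (j : Fin 3) :
    AnalyticAt ℝ (fun q => mPhiIcc q j) p :=
  ((analyticAt_mZero hp j).smul analyticAt_const).add
    ((analyticAt_nZero hp j).smul analyticAt_const)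

theorem analyticAt_nPhiIcc {p : ℝ × ℝ} (hp : p.1 ^ 2 + p.2 ^ 2 < 1) (j : Fin 3) :
    AnalyticAt ℝ (fun q => nPhiIcc q j) p :=
  ((analyticAt_nZero hp j).smul analyticAt_const).sub
    ((analyticAt_mZero hp j).smul analyticAt_const)

variable {C : Fin 3 → Fin 3 → Fin 3 → Fin 3 → ℝ}

theorem analyticAt_contractIcc {u v : ℝ × ℝ → Fin 3 → C(Set.Icc 0 (2 * Real.pi), ℝ)} {p : ℝ × ℝ}
    (hu : ∀ j, AnalyticAt ℝ (fun q => u q j) p) (hv : ∀ j, AnalyticAt ℝ (fun q => v q j) p)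
    (i k : Fin 3) : AnalyticAt ℝ (fun q => contractIcc C (u q) (v q) i k) p := by
  simp only [contractIcc, Matrix.of_apply]
  exact Finset.analyticAt_fun_sum _ fun j _ => Finset.analyticAt_fun_sum _ fun l _ =>
    analyticAt_const.fun_smul ((hu j).fun_mul (hv l))

/-- Evaluation at a point of `[0, 2π]`. -/
noncomputable def evalIcc (φ : Set.Icc 0 (2 * Real.pi)) : C(Set.Icc 0 (2 * Real.pi), ℝ) →+* ℝ :=
  (ContinuousMap.evalAlgHom ℝ ℝ φ).toRingHom

theorem contractIcc_map_evalIcc_nPhiIcc (p : ℝ × ℝ) (φ : Set.Icc 0 (2 * Real.pi)) :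
    (contractIcc C (nPhiIcc p) (nPhiIcc p)).map (evalIcc φ) = acousticT C (nPhi (lVec p) φ) := by
  ext i k
  simp [evalIcc, contractIcc, acousticT, nPhiIcc_apply, mul_assoc]

theorem contractIcc_map_evalIcc_mPhiIcc (p : ℝ × ℝ) (φ : Set.Icc 0 (2 * Real.pi)) :
    (contractIcc C (mPhiIcc p) (nPhiIcc p)).map (evalIcc φ) =
      matR C (mPhi (lVec p) φ) (nPhi (lVec p) φ) := by
  ext i k
  simp [evalIcc, contractIcc, matR, mPhiIcc_apply, nPhiIcc_apply, mul_assoc]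

theorem isUnit_det_contractIcc {p : ℝ × ℝ}
    (hT : ∀ φ, (acousticT C (nPhi (lVec p) φ)).PosDef) :
    IsUnit (contractIcc C (nPhiIcc p) (nPhiIcc p)).det := by
  rw [ContinuousMap.isUnit_iff_forall_ne_zero]
  intro φ
  change evalIcc φ (contractIcc C (nPhiIcc p) (nPhiIcc p)).det ≠ 0
  rw [RingHom.map_det, RingHom.mapMatrix_apply, contractIcc_map_evalIcc_nPhiIcc]
  exact (hT φ).det_pos.ne'

theorem inv_contractIcc_map_evalIcc {p : ℝ × ℝ}
    (hT : ∀ φ, (acousticT C (nPhi (lVec p) φ)).PosDef) (φ : Set.Icc 0 (2 * Real.pi)) :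
    (contractIcc C (nPhiIcc p) (nPhiIcc p))⁻¹.map (evalIcc φ) =
      (acousticT C (nPhi (lVec p) φ))⁻¹ := by
  rw [Matrix.map_inv_of_isUnit_det _ (isUnit_det_contractIcc hT),
    contractIcc_map_evalIcc_nPhiIcc]

theorem STwo_apply_eq {p : ℝ × ℝ} (hT : ∀ φ, (acousticT C (nPhi (lVec p) φ)).PosDef)
    (i k : Fin 3) :
    STwo C (lVec p) i k = (2 * Real.pi)⁻¹ * integralIccCLM Real.two_pi_pos.le
      ((contractIcc C (nPhiIcc p) (nPhiIcc p))⁻¹ i k) := by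
  rw [integralIccCLM_eq (g := fun φ => (acousticT C (nPhi (lVec p) φ))⁻¹ i k)]
  · rfl
  · exact fun φ => congrFun₂ (inv_contractIcc_map_evalIcc hT φ) i k

theorem SOne_apply_eq {p : ℝ × ℝ} (hT : ∀ φ, (acousticT C (nPhi (lVec p) φ)).PosDef)
    (i k : Fin 3) :
    SOne C (lVec p) i k = -(2 * Real.pi)⁻¹ * integralIccCLM Real.two_pi_pos.le
      (((contractIcc C (nPhiIcc p) (nPhiIcc p))⁻¹ *
        (contractIcc C (mPhiIcc p) (nPhiIcc p)).transpose) i k) := by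
  rw [integralIccCLM_eq (g := fun φ => ((acousticT C (nPhi (lVec p) φ))⁻¹ *
    (matR C (mPhi (lVec p) φ) (nPhi (lVec p) φ)).transpose) i k)]
  · rfl
  · intro φ
    rw [← inv_contractIcc_map_evalIcc hT, ← contractIcc_map_evalIcc_mPhiIcc,
      ← Matrix.transpose_map, ← Matrix.map_mul]
    rfl

theorem STwo_posDef {p : ℝ × ℝ} (hT : ∀ φ, (acousticT C (nPhi (lVec p) φ)).PosDef) :
    (STwo C (lVec p)).PosDef := by
  refine Matrix.PosDef.of_dotProduct_mulVec_pos ?_ fun v hv => ?_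
  · ext i k
    simp only [STwo, Matrix.conjTranspose_apply, Matrix.of_apply, star_trivial]
    congr 2
    ext φ
    simpa using (hT φ).inv.isHermitian.apply i k
  · have hquad : star v ⬝ᵥ (STwo C (lVec p)).mulVec v =
        (2 * Real.pi)⁻¹ * integralIccCLM Real.two_pi_pos.le
          (∑ i, ∑ k, (v i * v k) • (contractIcc C (nPhiIcc p) (nPhiIcc p))⁻¹ i k) := by
      simp only [star_trivial, dotProduct, Matrix.mulVec, STwo_apply_eq hT, map_sum, map_smul,
        Finset.mul_sum, smul_eq_mul]
      refine Finset.sum_congr rfl fun i _ => Finset.sum_congr rfl fun k _ => ?_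
      ring
    rw [hquad]
    refine mul_pos (inv_pos.mpr Real.two_pi_pos) (integralIccCLM_pos Real.two_pi_pos fun φ => ?_)
    have hpos := (hT φ).inv.dotProduct_mulVec_pos hv
    rw [← inv_contractIcc_map_evalIcc hT φ] at hpos
    refine hpos.trans_eq ?_
    simp only [star_trivial, dotProduct, Matrix.mulVec, Finset.mul_sum, ContinuousMap.sum_apply,
      ContinuousMap.smul_apply, smul_eq_mul]
    refine Finset.sum_congr rfl fun i _ => Finset.sum_congr rfl fun k _ => ?_
    change v i * ((contractIcc C (nPhiIcc p) (nPhiIcc p))⁻¹ i k φ * v k) = _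
    ring

end Lift

theorem surfaceImpedance_analytic
    (C : Fin 3 → Fin 3 → Fin 3 → Fin 3 → ℝ)
    (hsym1 : ∀ i j k l, C i j k l = C i j l k)
    (hsym2 : ∀ i j k l, C i j k l = C k l i j)
    (hconv : ∃ lam : ℝ, 0 < lam ∧ ∀ ε : Matrix (Fin 3) (Fin 3) ℝ, ε.IsSymm →
      lam * ∑ i, ∑ j, (ε i j) ^ 2 ≤ ∑ i, ∑ j, ∑ k, ∑ l, C i j k l * ε i j * ε k l) :
    ∀ i k : Fin 3,
      AnalyticOnNhd ℝ (fun p : ℝ × ℝ => surfaceImpedance C (lVec p) i k)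
        {p : ℝ × ℝ | p.1 ^ 2 + p.2 ^ 2 < 1} := by
  intro i k p hp
  have hT : ∀ q ∈ {q : ℝ × ℝ | q.1 ^ 2 + q.2 ^ 2 < 1}, ∀ φ,
      (acousticT C (nPhi (lVec q) φ)).PosDef :=
    fun q hq φ => acousticT_posDef hsym1 hsym2 hconv (nPhi_ne_zero hq φ)
  have hopen : IsOpen {q : ℝ × ℝ | q.1 ^ 2 + q.2 ^ 2 < 1} :=
    isOpen_lt (by fun_prop) continuous_const
  have hev := hopen.mem_nhds hp
  have hTinv : ∀ i k, AnalyticAt ℝ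
      (fun q => (contractIcc C (nPhiIcc q) (nPhiIcc q))⁻¹ i k) p :=
    analyticAt_matrix_inv
      (analyticAt_contractIcc (analyticAt_nPhiIcc hp) (analyticAt_nPhiIcc hp))
      (isUnit_det_contractIcc (hT p hp))
  have hS2 : ∀ i k, AnalyticAt ℝ (fun q => STwo C (lVec q) i k) p := fun i k => by
    refine AnalyticAt.congr ((analyticAt_const (v := (2 * Real.pi)⁻¹)).fun_mul
      (((integralIccCLM Real.two_pi_pos.le).analyticAt _).fun_comp (hTinv i k))) ?_
    filter_upwards [hev] with q hq using (STwo_apply_eq (hT q hq) i k).symm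
  have hS1 : ∀ i k, AnalyticAt ℝ (fun q => SOne C (lVec q) i k) p := fun i k => by
    refine AnalyticAt.congr ((analyticAt_const (v := -(2 * Real.pi)⁻¹)).fun_mul
      (((integralIccCLM Real.two_pi_pos.le).analyticAt _).fun_comp
        (analyticAt_matrix_mul (N := fun q => (contractIcc C (mPhiIcc q) (nPhiIcc q)).transpose)
          hTinv (fun i k => analyticAt_contractIcc
            (analyticAt_mPhiIcc hp) (analyticAt_nPhiIcc hp) k i) i k))) ?_
    filter_upwards [hev] with q hq using (SOne_apply_eq (hT q hq) i k).symm
  have hS2inv := analyticAt_matrix_inv hS2 (STwo_posDef (hT p hp)).det_pos.ne'.isUnit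
  exact ((Complex.ofRealCLM.analyticAt _).fun_comp (hS2inv i k)).add
    (analyticAt_const.mul ((Complex.ofRealCLM.analyticAt _).fun_comp
      (analyticAt_matrix_mul hS2inv hS1 i k)))
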